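/- Let ω₁, ω₂ be in the upper half-plane with arg(ω₁) < arg(ω₂), and let z = a₁ω₁ + a₂ω₂ with 0 < a₁, a₂ < 1. Then for all s with Re(s) > 2 (extended to all s by continuation), ζ₂(s, z | ω₁, ω₂) = (2π)^{s−1} Γ(1−s) [e^{πi(s−1)/2} (ω₁^{-s} Σ_{n≥1} n^{s−1} e^{2πinz/ω₁}/(1 − e^{2πinω₂/ω₁}) + ω₂^{-s} Σ_{n≥1} n^{s−1} e^{2πinz/ω₂}/(1 − e^{2πinω₁/ω₂})) + e^{−πi(s−1)/2} (ω₁^{-s} Σ_{n≥1} n^{s−1} e^{−2πinz/ω₁}/(1 − e^{−2πinω₂/ω₁}) + ω₂^{-s} Σ_{n≥1} n^{s−1} e^{−2πinz/ω₂}/(1 − e^{−2πinω₁/ω₂}))]. -/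

import Mathlib

open Complex Real

/-- The Barnes double zeta series `ζ₂(s, z | ω₁, ω₂)` (principal-branch powers),
convergent for `Re(s) > 2`. -/
noncomputable def barnesZeta2 (s z ω₁ ω₂ : ℂ) : ℂ :=
  ∑' p : ℕ × ℕ, (z + (p.1 : ℂ) * ω₁ + (p.2 : ℂ) * ω₂) ^ (-s)

section

open MeasureTheory Set Filter Topology Asymptotics FourierTransform

theorem integrableOn_rpow_mul_exp_neg_mul {a r : ℝ} (ha : 0 < a) (hr : 0 < r) :
    IntegrableOn (fun t : ℝ ↦ t ^ (a - 1) * rexp (-(r * t))) (Ioi 0) := by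
  simpa using integrableOn_rpow_mul_exp_neg_mul_rpow (p := 1) (s := a - 1) (by linarith)
    one_pos hr

theorem norm_rpow_mul_cexp {a t : ℝ} (ht : 0 ≤ t) (r : ℂ) :
    ‖((t ^ (a - 1) : ℝ) : ℂ) * cexp (-(r * t))‖ = t ^ (a - 1) * rexp (-(r.re * t)) := by
  rw [norm_mul, norm_real, Complex.norm_exp, Real.norm_of_nonneg (by positivity)]
  simp

theorem differentiableOn_integral_rpow_mul_cexp {a : ℝ} (ha : 0 < a) :
    DifferentiableOn ℂ (fun r : ℂ ↦ ∫ t in Ioi (0 : ℝ), ((t ^ (a - 1) : ℝ) : ℂ) * cexp (-(r * t)))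
      {r | 0 < r.re} := by
  intro r hr
  have hr' : 0 < r.re := hr
  have hmeas : ∀ b : ℝ, ∀ w : ℂ, AEStronglyMeasurable
      (fun t : ℝ ↦ ((t ^ (b - 1) : ℝ) : ℂ) * cexp (-(w * t))) (volume.restrict (Ioi 0)) := by
    intro b w
    have : Measurable (fun t : ℝ ↦ ((t ^ (b - 1) : ℝ) : ℂ) * cexp (-(w * t))) := by fun_prop
    exact this.aestronglyMeasurable
  have hopen : {w : ℂ | r.re / 2 < w.re} ∈ 𝓝 r :=
    (isOpen_lt continuous_const continuous_re).mem_nhds (show r.re / 2 < r.re by linarith)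
  refine ((hasDerivAt_integral_of_dominated_loc_of_deriv_le (x₀ := r)
    (F' := fun w t ↦ -(((t ^ (a + 1 - 1) : ℝ) : ℂ) * cexp (-(w * t))))
    (bound := fun t ↦ t ^ (a + 1 - 1) * rexp (-(r.re / 2 * t))) hopen
    (.of_forall fun w ↦ hmeas a w) ?_ (hmeas (a + 1) r).neg ?_
    (integrableOn_rpow_mul_exp_neg_mul (by linarith) (by linarith)) ?_).2
    ).differentiableAt.differentiableWithinAt
  · refine (integrableOn_rpow_mul_exp_neg_mul ha hr').mono' (hmeas a r) ?_
    filter_upwards [ae_restrict_mem measurableSet_Ioi] with t ht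
    exact (norm_rpow_mul_cexp (le_of_lt ht) r).le
  · filter_upwards [ae_restrict_mem measurableSet_Ioi] with t ht w hw
    have ht' : (0 : ℝ) < t := ht
    rw [norm_neg, norm_rpow_mul_cexp ht'.le]
    have : r.re / 2 < w.re := hw
    gcongr
  · filter_upwards [ae_restrict_mem measurableSet_Ioi] with t ht w hw
    have ht' : (0 : ℝ) < t := ht
    have h1 : ((t ^ (a + 1 - 1) : ℝ) : ℂ) = ((t ^ (a - 1) : ℝ) : ℂ) * t := by
      rw [← ofReal_mul, ← Real.rpow_add_one ht'.ne']
      ring_nf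
    have h2 := (((hasDerivAt_id w).mul_const (t : ℂ)).neg.cexp).const_mul
      ((t ^ (a - 1) : ℝ) : ℂ)
    refine h2.congr_deriv ?_
    simp only [h1, id, Pi.neg_apply]
    ring

theorem integral_rpow_mul_cexp {a : ℝ} (ha : 0 < a) {r : ℂ} (hr : 0 < r.re) :
    ∫ t in Ioi (0 : ℝ), ((t ^ (a - 1) : ℝ) : ℂ) * cexp (-(r * t)) =
      r ^ (-a : ℂ) * Complex.Gamma a := by
  have hopen : IsOpen {r : ℂ | 0 < r.re} := isOpen_lt continuous_const continuous_re
  refine AnalyticOnNhd.eqOn_of_preconnected_of_frequently_eq (z₀ := 1)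
    ((differentiableOn_integral_rpow_mul_cexp ha).analyticOnNhd hopen)
    (g := fun r ↦ r ^ (-a : ℂ) * Complex.Gamma a)
    (DifferentiableOn.analyticOnNhd (fun w hw ↦ ?_) hopen)
    (convex_halfSpace_re_gt 0).isPreconnected (by simp) ?_ hr
  · exact ((differentiableAt_id.cpow_const (.inl hw)).mul_const _).differentiableWithinAt
  · have hreal : ∀ x : ℝ, 0 < x → ∫ t in Ioi (0 : ℝ), ((t ^ (a - 1) : ℝ) : ℂ) *
        cexp (-((x : ℂ) * t)) = (x : ℂ) ^ (-a : ℂ) * Complex.Gamma a := by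
      intro x hx
      have h := Real.integral_rpow_mul_exp_neg_mul_Ioi ha hx
      rw [Complex.Gamma_ofReal, ← ofReal_neg, ← ofReal_cpow hx.le, ← ofReal_mul,
        Real.rpow_neg hx.le, ← Real.inv_rpow hx.le, ← one_div, ← h]
      refine Eq.trans (integral_congr_ae (.of_forall fun t ↦ ?_)) integral_ofReal
      simp
    have htend : Tendsto (fun x : ℝ ↦ (x : ℂ)) (𝓝[≠] 1) (𝓝[≠] 1) := by
      refine tendsto_nhdsWithin_iff.2 ⟨?_, ?_⟩
      · exact (continuous_ofReal.tendsto' 1 1 (by simp)).mono_left nhdsWithin_le_nhds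
      · filter_upwards [self_mem_nhdsWithin] with x hx
        simpa using hx
    refine htend.frequently (Eventually.frequently ?_)
    filter_upwards [nhdsWithin_le_nhds (Ioi_mem_nhds (zero_lt_one (α := ℝ)))] with x hx
    exact hreal x hx

theorem ofReal_mul_cpow {x : ℝ} (hx : 0 < x) {w : ℂ} (hw : w ≠ 0) (c : ℂ) :
    ((x : ℂ) * w) ^ c = (x : ℂ) ^ c * w ^ c := by
  have hx' : (x : ℂ) ≠ 0 := by exact_mod_cast hx.ne'
  rw [cpow_def_of_ne_zero (mul_ne_zero hx' hw), cpow_def_of_ne_zero hx', cpow_def_of_ne_zero hw,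
    log_ofReal_mul hx hw, add_mul, Complex.exp_add, ofReal_log hx.le]

/-- The Lipschitz summation formula, for real exponents. -/
theorem tsum_int_cpow_eq {s : ℝ} (hs : 1 < s) {u : ℂ} (hu : 0 < u.im) :
    ∑' m : ℤ, (-I * (u + m)) ^ (-s : ℂ) = (2 * π : ℂ) ^ (s : ℂ) / Complex.Gamma s *
      ∑' k : ℕ, ((k : ℂ) + 1) ^ (s - 1 : ℂ) * cexp (2 * π * I * (k + 1) * u) := by
  set f : ℝ → ℂ := fun x ↦ (((max x 0) ^ (s - 1) : ℝ) : ℂ) * cexp (2 * π * I * u * x) with hf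
  have hf0 : ∀ x ≤ 0, f x = 0 := fun x hx ↦ by
    simp [hf, max_eq_right hx, Real.zero_rpow (by linarith : s - 1 ≠ 0)]
  have hc : Continuous f := by
    have h1 : Continuous fun x : ℝ ↦ (max x 0) ^ (s - 1) :=
      (continuous_id.max continuous_const).rpow_const fun x ↦ .inr (by linarith)
    fun_prop
  have hdecay : f =O[cocompact ℝ] (|·| ^ (-s)) := by
    rw [cocompact_eq_atBot_atTop, isBigO_sup]
    constructor
    · refine (EventuallyEq.isBigO (f₂ := fun _ ↦ (0 : ℂ)) ?_).trans (isBigO_zero _ _)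
      filter_upwards [eventually_le_atBot 0] with x hx using hf0 x hx
    · have h1 := (isLittleO_exp_neg_mul_rpow_atTop (a := 2 * π * u.im) (by positivity)
        (-s - (s - 1))).isBigO
      have h2 := (isBigO_refl (fun x : ℝ ↦ x ^ (s - 1)) atTop).mul h1
      refine (IsBigO.of_norm_eventuallyLE ?_).trans (h2.trans (EventuallyEq.isBigO ?_))
      · filter_upwards [eventually_gt_atTop 0] with x hx
        simp only [hf]
        rw [norm_mul, norm_real, Complex.norm_exp, max_eq_left hx.le,
          Real.norm_of_nonneg (by positivity)]
        simp
      · filter_upwards [eventually_gt_atTop 0] with x hx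
        rw [← Real.rpow_add hx, abs_of_pos hx]
        ring_nf
  have hfour : ∀ y : ℝ, 𝓕 f y = (2 * π : ℂ) ^ (-s : ℂ) * Complex.Gamma s *
      (-I * (u - y)) ^ (-s : ℂ) := by
    intro y
    have hre : 0 < ((2 * π : ℝ) * (-I * (u - y)) : ℂ).re := by
      rw [re_ofReal_mul]
      simp
      positivity
    rw [fourier_real_eq_integral_exp_smul, ← setIntegral_eq_integral_of_forall_compl_eq_zero
      (s := Ioi 0) (fun x hx ↦ by simp [hf0 x (not_lt.1 hx)])]
    have h2 := integral_rpow_mul_cexp (a := s) (by linarith) hre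
    rw [ofReal_mul_cpow Real.two_pi_pos (fun h ↦ by simp [h] at hre)] at h2
    rw [mul_right_comm, ← ofReal_ofNat, ← ofReal_mul, ← h2]
    refine setIntegral_congr_fun measurableSet_Ioi fun t ht ↦ ?_
    simp only [hf, smul_eq_mul, max_eq_left (le_of_lt (mem_Ioi.1 ht))]
    rw [mul_left_comm, ← Complex.exp_add]
    congr 2
    push_cast
    ring
  have hdecay' : 𝓕 f =O[cocompact ℝ] (|·| ^ (-s)) := by
    refine IsBigO.of_bound (‖(2 * π : ℂ) ^ (-s : ℂ) * Complex.Gamma s‖ * 2⁻¹ ^ (-s)) ?_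
    filter_upwards [(tendsto_norm_cocompact_atTop (E := ℝ)).eventually_ge_atTop (2 * ‖u‖),
      (tendsto_norm_cocompact_atTop (E := ℝ)).eventually_gt_atTop 0] with y hy hy0
    rw [hfour, norm_mul, mul_assoc, ← ofReal_neg, norm_cpow_real]
    rw [Real.norm_of_nonneg (by positivity), ← Real.mul_rpow (by norm_num) (abs_nonneg _)]
    rw [Real.norm_eq_abs] at hy hy0
    refine mul_le_mul_of_nonneg_left (Real.rpow_le_rpow_of_nonpos (by positivity) ?_
      (by linarith)) (norm_nonneg _)
    have h1 := norm_sub_norm_le (y : ℂ) u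
    rw [norm_real, Real.norm_eq_abs] at h1
    rw [norm_mul, norm_neg, norm_I, one_mul, norm_sub_rev]
    linarith
  have hpois := Real.tsum_eq_tsum_fourier_of_rpow_decay hc hs hdecay hdecay' 0
  have hinj : Function.Injective fun k : ℕ ↦ (k + 1 : ℤ) := fun a b h ↦ by simpa using h
  rw [← hinj.tsum_eq] at hpois
  · have hG : Complex.Gamma s ≠ 0 := Complex.Gamma_ne_zero_of_re_pos (by simp; linarith)
    have hpi : (2 * π : ℂ) ≠ 0 := by simp [Real.pi_ne_zero]
    have hR : ∑' n : ℤ, 𝓕 f n * fourier n ((0 : ℝ) : UnitAddCircle) =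
        (2 * π : ℂ) ^ (-s : ℂ) * Complex.Gamma s * ∑' m : ℤ, (-I * (u + m)) ^ (-s : ℂ) := by
      rw [← tsum_mul_left, ← (Equiv.neg ℤ).tsum_eq]
      refine tsum_congr fun m ↦ ?_
      rw [hfour, fourier_coe_apply]
      simp
    have hL : ∀ k : ℕ, f (0 + ((k + 1 : ℤ) : ℝ)) =
        ((k : ℂ) + 1) ^ (s - 1 : ℂ) * cexp (2 * π * I * (k + 1) * u) := by
      intro k
      have hk : (0 : ℝ) ≤ k + 1 := by positivity
      simp only [hf]
      push_cast
      rw [zero_add, max_eq_left hk, ofReal_cpow hk]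
      push_cast
      ring_nf
    rw [hR, tsum_congr hL] at hpois
    rw [hpois, cpow_neg]
    field_simp
  · intro n hn
    rw [Function.mem_support] at hn
    have hn' : 0 < n := by
      by_contra h
      exact hn (hf0 _ (by simpa using h))
    exact ⟨(n - 1).toNat, by simp; omega⟩

theorem summable_lattice_rpow {s : ℝ} (hs : 2 < s) (ξ : ℂ) {τ : ℂ} (hτ : 0 < τ.im) :
    Summable fun p : ℤ × ℤ ↦ ‖ξ + p.2 + p.1 * τ‖ ^ (-s) := by
  set z : UpperHalfPlane := ⟨τ, hτ⟩
  have hr := EisensteinSeries.r_pos z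
  set r := EisensteinSeries.r z
  rw [← (finTwoArrowEquiv ℤ).summable_iff]
  refine EisensteinSeries.summable_of_isBigO_rpow_norm hs
    (IsBigO.of_bound ((r / 2) ^ (-s)) ?_)
  have htend : Tendsto (fun x : Fin 2 → ℤ ↦ ‖x‖) cofinite atTop := by
    rw [← cocompact_eq_cofinite]
    exact tendsto_norm_cocompact_atTop
  filter_upwards [htend.eventually_ge_atTop (2 * ‖ξ‖ / r), htend.eventually_gt_atTop 0]
    with x hx hx0
  have h1 := EisensteinSeries.r_mul_max_le z (norm_pos_iff.1 hx0)
  rw [div_le_iff₀ hr] at hx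
  simp only [Function.comp_apply]
  rw [← Real.rpow_neg hx0.le, Real.norm_of_nonneg (Real.rpow_nonneg (norm_nonneg _) _),
    Real.norm_of_nonneg (Real.rpow_nonneg hx0.le _), ← Real.mul_rpow (half_pos hr).le hx0.le]
  refine Real.rpow_le_rpow_of_nonpos (by positivity) ?_ (by linarith)
  have h2 := norm_sub_le_norm_add (x 0 * τ + x 1 : ℂ) ξ
  have h3 : ‖ξ + ((finTwoArrowEquiv ℤ) x).2 + ((finTwoArrowEquiv ℤ) x).1 * τ‖ =
      ‖(x 0 * τ + x 1 : ℂ) + ξ‖ := by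
    congr 1
    simp [finTwoArrowEquiv]
    ring
  rw [h3]
  have h1' : r * ‖x‖ ≤ ‖(x 0 * τ + x 1 : ℂ)‖ := h1
  linarith

/-- The series `∑_{n ≥ 1} n^(s-1) e^{2πinξ} / (1 - e^{2πinτ})`. -/
noncomputable def expQuotientSeries (ξ τ s : ℂ) : ℂ :=
  ∑' n : ℕ, ((n : ℂ) + 1) ^ (s - 1) * cexp (2 * π * I * ((n : ℂ) + 1) * ξ) /
    (1 - cexp (2 * π * I * ((n : ℂ) + 1) * τ))

theorem norm_cexp_two_pi_mul (n : ℕ) (ξ : ℂ) :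
    ‖cexp (2 * π * I * ((n : ℂ) + 1) * ξ)‖ = rexp (-(2 * π * ξ.im)) ^ (n + 1) := by
  rw [Complex.norm_exp, ← Real.exp_nat_mul]
  congr 1
  simp
  ring

theorem exp_neg_two_pi_im_lt_one {ξ : ℂ} (hξ : 0 < ξ.im) : rexp (-(2 * π * ξ.im)) < 1 := by
  rw [Real.exp_lt_one_iff]
  have := Real.two_pi_pos
  nlinarith [mul_pos this hξ]

theorem summable_rpow_mul_exp {ξ : ℂ} (hξ : 0 < ξ.im) (b : ℝ) :
    Summable fun n : ℕ ↦ ((n : ℝ) + 1) ^ b * rexp (-(2 * π * ξ.im)) ^ (n + 1) := by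
  obtain ⟨k, hk⟩ := exists_nat_ge b
  have h1 := summable_pow_mul_geometric_of_norm_lt_one (R := ℝ) k
    (r := rexp (-(2 * π * ξ.im)))
    (by rw [Real.norm_of_nonneg (Real.exp_pos _).le]; exact exp_neg_two_pi_im_lt_one hξ)
  refine ((summable_nat_add_iff 1).2 h1).of_nonneg_of_le (fun n ↦ by positivity) fun n ↦ ?_
  have : ((n : ℝ) + 1) ^ b ≤ ((n : ℝ) + 1) ^ k := by
    rw [← Real.rpow_natCast]
    exact Real.rpow_le_rpow_of_exponent_le (by linarith [n.cast_nonneg (α := ℝ)]) hk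
  push_cast
  gcongr

theorem norm_natCast_add_one_cpow (n : ℕ) (s : ℂ) :
    ‖((n : ℂ) + 1) ^ s‖ = ((n : ℝ) + 1) ^ s.re := by
  rw [← norm_cpow_eq_rpow_re_of_pos (by positivity)]
  push_cast
  rfl

theorem differentiable_expQuotientSeries {ξ τ : ℂ} (hξ : 0 < ξ.im) (hτ : 0 < τ.im) :
    Differentiable ℂ (expQuotientSeries ξ τ) := by
  intro s
  have hq := exp_neg_two_pi_im_lt_one hτ
  have hopen : IsOpen {w : ℂ | w.re < s.re + 1} := isOpen_lt continuous_re continuous_const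
  refine (differentiableOn_tsum_of_summable_norm
    ((summable_rpow_mul_exp hξ s.re).mul_right (1 - rexp (-(2 * π * τ.im)))⁻¹) (fun n ↦ ?_) hopen
    (fun n w hw ↦ ?_)).differentiableAt (hopen.mem_nhds (show s.re < s.re + 1 by linarith))
  · have hn : (n : ℂ) + 1 ≠ 0 := by exact_mod_cast n.succ_ne_zero
    refine Differentiable.differentiableOn ?_
    refine ((Differentiable.const_cpow (by fun_prop) (.inl hn)).mul_const _).div_const _
  · rw [norm_div, norm_mul, norm_cexp_two_pi_mul, norm_natCast_add_one_cpow, div_eq_mul_inv]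
    have h1 : 1 - rexp (-(2 * π * τ.im)) ≤ ‖1 - cexp (2 * π * I * ((n : ℂ) + 1) * τ)‖ := by
      have h2 := norm_sub_norm_le 1 (cexp (2 * π * I * ((n : ℂ) + 1) * τ))
      rw [norm_one, norm_cexp_two_pi_mul] at h2
      have h3 : rexp (-(2 * π * τ.im)) ^ (n + 1) ≤ rexp (-(2 * π * τ.im)) :=
        pow_le_of_le_one (Real.exp_pos _).le hq.le n.succ_ne_zero
      linarith
    have hw' : (w - 1).re ≤ s.re := by
      have : w.re < s.re + 1 := hw
      simp
      linarith
    have h0 : 0 < 1 - rexp (-(2 * π * τ.im)) := by linarith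
    gcongr
    linarith [n.cast_nonneg (α := ℝ)]

theorem tsum_tsum_exp_eq_expQuotientSeries {ξ τ : ℂ} (hξ : 0 < ξ.im) (hτ : 0 < τ.im) (s : ℂ) :
    ∑' n : ℕ, ∑' k : ℕ, ((k : ℂ) + 1) ^ (s - 1) * cexp (2 * π * I * (k + 1) * (ξ + n * τ)) =
      expQuotientSeries ξ τ s := by
  have hq := exp_neg_two_pi_im_lt_one hτ
  have hq0 := Real.exp_pos (-(2 * π * τ.im))
  have hterm : ∀ n k : ℕ, cexp (2 * π * I * (k + 1) * (ξ + n * τ)) =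
      cexp (2 * π * I * (k + 1) * ξ) * cexp (2 * π * I * (k + 1) * τ) ^ n := by
    intro n k
    rw [← Complex.exp_nat_mul, ← Complex.exp_add]
    congr 1
    ring
  have hsum : Summable (Function.uncurry fun k n : ℕ ↦
      ((k : ℂ) + 1) ^ (s - 1) * cexp (2 * π * I * (k + 1) * (ξ + n * τ))) := by
    refine Summable.of_norm_bounded ((summable_rpow_mul_exp hξ (s - 1).re).mul_of_nonneg
      (summable_geometric_of_lt_one hq0.le hq) (fun k ↦ by positivity) fun n ↦ by positivity)
      fun ⟨k, n⟩ ↦ ?_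
    simp only [Function.uncurry]
    rw [hterm, norm_mul, norm_mul, norm_pow, norm_cexp_two_pi_mul, norm_cexp_two_pi_mul,
      norm_natCast_add_one_cpow]
    refine (mul_assoc _ _ _).symm.le.trans ?_
    gcongr
    exact pow_le_of_le_one hq0.le hq.le k.succ_ne_zero
  rw [hsum.tsum_comm, expQuotientSeries]
  refine tsum_congr fun k ↦ ?_
  simp_rw [hterm]
  rw [tsum_mul_left, tsum_mul_left, tsum_geometric_of_norm_lt_one, mul_assoc, mul_div_assoc,
    div_eq_mul_inv]
  rw [norm_cexp_two_pi_mul]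
  exact pow_lt_one₀ hq0.le hq k.succ_ne_zero

theorem tsum_half_lattice_cpow {s : ℝ} (hs : 2 < s) {ξ τ : ℂ} (hξ : 0 < ξ.im) (hτ : 0 < τ.im) :
    ∑' p : ℕ × ℕ, (-I * (ξ + p.1 + p.2 * τ)) ^ (-s : ℂ) +
      ∑' p : ℕ × ℕ, (-I * (ξ - (p.1 + 1) + p.2 * τ)) ^ (-s : ℂ) =
    (2 * π : ℂ) ^ (s : ℂ) / Complex.Gamma s * expQuotientSeries ξ τ s := by
  set h : ℤ × ℤ → ℂ := fun p ↦ (-I * (ξ + p.2 + p.1 * τ)) ^ (-s : ℂ) with h_def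
  have hsum : Summable h := by
    refine .of_norm ((summable_lattice_rpow hs ξ hτ).congr fun p ↦ ?_)
    rw [h_def, ← ofReal_neg, norm_cpow_real]
    simp
  have hinj₁ : Function.Injective fun p : ℕ × ℕ ↦ ((p.1 : ℤ), (p.2 : ℤ)) := by
    rintro ⟨a, b⟩ ⟨c, d⟩ h
    simpa using h
  have hinj₂ : Function.Injective fun p : ℕ × ℕ ↦ ((p.1 : ℤ), -((p.2 : ℤ) + 1)) := by
    rintro ⟨a, b⟩ ⟨c, d⟩ h
    simpa using h
  have hs₁ : Summable fun p : ℕ × ℕ ↦ h (p.1, p.2) := hsum.comp_injective hinj₁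
  have hs₂ : Summable fun p : ℕ × ℕ ↦ h (p.1, -((p.2 : ℤ) + 1)) := hsum.comp_injective hinj₂
  have h₁ : ∑' p : ℕ × ℕ, (-I * (ξ + p.1 + p.2 * τ)) ^ (-s : ℂ) =
      ∑' n : ℕ, ∑' m : ℕ, h (n, (m : ℤ)) := by
    rw [← (Equiv.prodComm ℕ ℕ).tsum_eq]
    refine Eq.trans (tsum_congr fun p ↦ ?_) hs₁.tsum_prod
    simp [h_def]
  have h₂ : ∑' p : ℕ × ℕ, (-I * (ξ - (p.1 + 1) + p.2 * τ)) ^ (-s : ℂ) =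
      ∑' n : ℕ, ∑' m : ℕ, h (n, -((m : ℤ) + 1)) := by
    rw [← (Equiv.prodComm ℕ ℕ).tsum_eq]
    refine Eq.trans (tsum_congr fun p ↦ ?_) hs₂.tsum_prod
    simp [h_def]
    ring_nf
  rw [h₁, h₂, ← hs₁.prod.tsum_add hs₂.prod, ← tsum_tsum_exp_eq_expQuotientSeries hξ hτ,
    ← tsum_mul_left]
  refine tsum_congr fun n ↦ ?_
  have him : 0 < (ξ + n * τ).im := by
    simp
    positivity
  rw [← tsum_int_cpow_eq (by linarith) him]
  refine (tsum_of_nat_of_neg_add_one (f := fun m : ℤ ↦ h (n, m)) (hs₁.prod_factor n)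
    (hs₂.prod_factor n)).symm.trans (tsum_congr fun m ↦ ?_)
  simp only [h_def]
  push_cast
  ring_nf

theorem cpow_mul_cpow_eq_exp_mul {ω v ω' v' : ℂ} (hω : ω ≠ 0) (hv : v ≠ 0) (hω' : ω' ≠ 0)
    (hv' : v' ≠ 0) {θ : ℝ} (h : ω * v = cexp (θ * I) * (ω' * v'))
    (harg : |ω.arg + v.arg - (ω'.arg + v'.arg + θ)| < 2 * π) (c : ℂ) :
    ω ^ c * v ^ c = cexp (θ * I * c) * (ω' ^ c * v' ^ c) := by
  have hexp : cexp (Complex.log ω + Complex.log v) =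
      cexp (Complex.log ω' + Complex.log v' + θ * I) := by
    simp only [Complex.exp_add, Complex.exp_log, hω, hv, hω', hv', h, Ne, not_false_eq_true]
    ring
  obtain ⟨n, hn⟩ := Complex.exp_eq_exp_iff_exists_int.1 hexp
  have him := congrArg Complex.im hn
  simp only [add_im, Complex.log_im, mul_im, ofReal_re, ofReal_im, I_re, I_im, intCast_re,
    intCast_im, mul_re, re_ofNat, im_ofNat] at him
  have hn0 : n = 0 := by
    have h1 : ω.arg + v.arg - (ω'.arg + v'.arg + θ) = n * (2 * π) := by linarith
    rw [h1, abs_mul, abs_of_pos Real.two_pi_pos] at harg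
    have h2 : |(n : ℝ)| < 1 := by
      by_contra! h3
      nlinarith [Real.two_pi_pos]
    rw [← Int.cast_abs] at h2
    exact Int.abs_lt_one_iff.1 (by exact_mod_cast h2)
  rw [hn0] at hn
  rw [cpow_def_of_ne_zero hω, cpow_def_of_ne_zero hv, cpow_def_of_ne_zero hω',
    cpow_def_of_ne_zero hv', ← Complex.exp_add, ← Complex.exp_add, ← Complex.exp_add, ← add_mul,
    hn]
  congr 1
  push_cast
  ring

theorem abs_arg_neg_I_mul_lt {u : ℂ} (hu : 0 < u.im) : |(-I * u).arg| < π / 2 :=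
  abs_arg_lt_pi_div_two_iff.2 (.inl (by simpa using hu))

theorem neg_I_mul_ne_zero {u : ℂ} (hu : 0 < u.im) : -I * u ≠ 0 :=
  mul_ne_zero (neg_ne_zero.2 I_ne_zero) fun h ↦ by simp [h] at hu

theorem arg_mem_Ioo_of_im_pos {w : ℂ} (hw : 0 < w.im) : 0 < w.arg ∧ w.arg < π := by
  refine ⟨(arg_nonneg_iff.2 hw.le).lt_of_ne fun h ↦ ?_, (arg_le_pi w).lt_of_ne fun h ↦ ?_⟩
  · exact hw.ne' (arg_eq_zero_iff.1 h.symm).2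
  · exact hw.ne' (arg_eq_pi_iff.1 h).2

theorem div_im_pos_of_arg_lt {ω₁ ω₂ : ℂ} (h₁ : 0 < ω₁.im) (h₂ : 0 < ω₂.im)
    (harg : ω₁.arg < ω₂.arg) : 0 < (ω₂ / ω₁).im := by
  have hω₁ : ω₁ ≠ 0 := fun h ↦ by simp [h] at h₁
  have hω₂ : ω₂ ≠ 0 := fun h ↦ by simp [h] at h₂
  have h : ω₂ / ω₁ = ((‖ω₂‖ / ‖ω₁‖ : ℝ) : ℂ) * cexp ((ω₂.arg - ω₁.arg : ℝ) * I) := by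
    conv_lhs => rw [← norm_mul_exp_arg_mul_I ω₂, ← norm_mul_exp_arg_mul_I ω₁]
    push_cast
    rw [sub_mul, Complex.exp_sub]
    field_simp
  rw [h, im_ofReal_mul, exp_ofReal_mul_I_im]
  have := arg_mem_Ioo_of_im_pos h₁
  have := arg_mem_Ioo_of_im_pos h₂
  refine mul_pos (by positivity) (Real.sin_pos_of_pos_of_lt_pi ?_ ?_) <;> linarith

theorem neg_div_im_pos_of_arg_lt {ω₁ ω₂ : ℂ} (h₁ : 0 < ω₁.im) (h₂ : 0 < ω₂.im)
    (harg : ω₁.arg < ω₂.arg) : 0 < (-(ω₁ / ω₂)).im := by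
  have h := div_im_pos_of_arg_lt h₁ h₂ harg
  rw [← inv_div, neg_im, inv_im, neg_div, neg_neg]
  refine div_pos h (normSq_pos.2 fun h0 ↦ ?_)
  simp [h0] at h

theorem im_real_add_mul_pos {τ : ℂ} (hτ : 0 < τ.im) (a : ℝ) {b : ℝ} (hb : 0 < b) :
    0 < ((a : ℂ) + b * τ).im := by
  simp
  positivity

theorem im_add_natCast_add_pos {ξ τ : ℂ} (hξ : 0 < ξ.im) (hτ : 0 < τ.im) (m n : ℕ) :
    0 < (ξ + m + n * τ).im := by
  simp
  positivity

theorem im_sub_natCast_add_pos {ξ τ : ℂ} (hξ : 0 < ξ.im) (hτ : 0 < τ.im) (m n : ℕ) :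
    0 < (ξ - (m + 1) + n * τ).im := by
  simp
  positivity

theorem barnesZeta2_eq_expQuotientSeries {ω₁ ω₂ : ℂ} (h₁ : 0 < ω₁.im) (h₂ : 0 < ω₂.im)
    (harg : ω₁.arg < ω₂.arg)
    {a₁ a₂ : ℝ} (ha₁ : 0 < a₁) (ha₁' : a₁ < 1) (ha₂ : 0 < a₂) (ha₂' : a₂ < 1)
    {s : ℝ} (hs : 2 < s) (hsin : Complex.sin (π * s) ≠ 0) :
    barnesZeta2 s (a₁ * ω₁ + a₂ * ω₂) ω₁ ω₂ =
      (2 * π : ℂ) ^ (s - 1 : ℂ) * Complex.Gamma (1 - s) *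
      (cexp (π * I * (s - 1) / 2) *
          (ω₁ ^ (-s : ℂ) * expQuotientSeries (a₁ + a₂ * (ω₂ / ω₁)) (ω₂ / ω₁) s
            + ω₂ ^ (-s : ℂ) *
              -expQuotientSeries (a₂ + (1 - a₁ : ℝ) * -(ω₁ / ω₂)) (-(ω₁ / ω₂)) s)
        + cexp (-(π * I * (s - 1)) / 2) *
          (ω₁ ^ (-s : ℂ) *
              -expQuotientSeries ((1 - a₁ : ℝ) + (1 - a₂ : ℝ) * (ω₂ / ω₁)) (ω₂ / ω₁) s
            + ω₂ ^ (-s : ℂ) *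
              expQuotientSeries ((1 - a₂ : ℝ) + a₁ * -(ω₁ / ω₂)) (-(ω₁ / ω₂)) s)) := by
  have hω₁ : ω₁ ≠ 0 := fun h ↦ by simp [h] at h₁
  have hω₂ : ω₂ ≠ 0 := fun h ↦ by simp [h] at h₂
  have hτ := div_im_pos_of_arg_lt h₁ h₂ harg
  have hτ' := neg_div_im_pos_of_arg_lt h₁ h₂ harg
  obtain ⟨hφ₁, hφ₁'⟩ := arg_mem_Ioo_of_im_pos h₁
  obtain ⟨hφ₂, hφ₂'⟩ := arg_mem_Ioo_of_im_pos h₂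
  have hξ₁ := im_real_add_mul_pos hτ a₁ ha₂
  have hξ₂ := im_real_add_mul_pos hτ' a₂ (sub_pos.2 ha₁')
  have hξ₃ := im_real_add_mul_pos hτ (1 - a₁) (sub_pos.2 ha₂')
  have hξ₄ := im_real_add_mul_pos hτ' (1 - a₂) ha₁
  have H₁ := tsum_half_lattice_cpow hs hξ₁ hτ
  have H₂ := tsum_half_lattice_cpow hs hξ₂ hτ'
  have H₃ := tsum_half_lattice_cpow hs hξ₃ hτ
  have H₄ := tsum_half_lattice_cpow hs hξ₄ hτ'
  set ξ₁ : ℂ := a₁ + a₂ * (ω₂ / ω₁) with hξ₁_def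
  set ξ₂ : ℂ := a₂ + (1 - a₁ : ℝ) * -(ω₁ / ω₂) with hξ₂_def
  set ξ₃ : ℂ := (1 - a₁ : ℝ) + (1 - a₂ : ℝ) * (ω₂ / ω₁) with hξ₃_def
  set ξ₄ : ℂ := (1 - a₂ : ℝ) + a₁ * -(ω₁ / ω₂) with hξ₄_def
  have hQ₁ : ω₁ ^ (-s : ℂ) * ∑' p : ℕ × ℕ, (-I * (ξ₁ + p.1 + p.2 * (ω₂ / ω₁))) ^ (-s : ℂ) =
      cexp (π * I * s / 2) * barnesZeta2 s (a₁ * ω₁ + a₂ * ω₂) ω₁ ω₂ := by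
    rw [barnesZeta2, ← tsum_mul_left, ← tsum_mul_left]
    refine tsum_congr fun p ↦ ?_
    have him := im_add_natCast_add_pos hξ₁ hτ p.1 p.2
    have hw : 0 < (a₁ * ω₁ + a₂ * ω₂ + p.1 * ω₁ + p.2 * ω₂ : ℂ).im := by
      simp
      positivity
    have hw0 : (a₁ * ω₁ + a₂ * ω₂ + p.1 * ω₁ + p.2 * ω₂ : ℂ) ≠ 0 := fun h ↦ by simp [h] at hw
    obtain ⟨hφ, hφ'⟩ := arg_mem_Ioo_of_im_pos hw
    obtain ⟨hv, hv'⟩ := abs_lt.1 (abs_arg_neg_I_mul_lt him)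
    rw [cpow_mul_cpow_eq_exp_mul (θ := -(π / 2)) hω₁ (neg_I_mul_ne_zero him) hw0 one_ne_zero,
      one_cpow, mul_one]
    · congr 2
      push_cast
      ring
    · have h : cexp ((-(π / 2) : ℝ) * I) = -I := by
        push_cast
        rw [neg_mul, Complex.exp_neg, Complex.exp_pi_div_two_mul_I, inv_I]
      rw [h, hξ₁_def]
      field_simp
    · rw [arg_one, abs_lt]
      constructor <;> linarith
  have hQ₁' : ω₂ ^ (-s : ℂ) *
      ∑' p : ℕ × ℕ, (-I * (ξ₄ - (p.1 + 1) + p.2 * -(ω₁ / ω₂))) ^ (-s : ℂ) =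
      cexp (-(π * I * s / 2)) * barnesZeta2 s (a₁ * ω₁ + a₂ * ω₂) ω₁ ω₂ := by
    rw [barnesZeta2, ← tsum_mul_left, ← tsum_mul_left, ← (Equiv.prodComm ℕ ℕ).tsum_eq]
    refine tsum_congr fun ⟨m, n⟩ ↦ ?_
    simp only [Equiv.prodComm_apply, Prod.swap_prod_mk]
    have him := im_sub_natCast_add_pos hξ₄ hτ' n m
    have hw : 0 < (a₁ * ω₁ + a₂ * ω₂ + m * ω₁ + n * ω₂ : ℂ).im := by
      simp
      positivity
    have hw0 : (a₁ * ω₁ + a₂ * ω₂ + m * ω₁ + n * ω₂ : ℂ) ≠ 0 := fun h ↦ by simp [h] at hw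
    obtain ⟨hφ, hφ'⟩ := arg_mem_Ioo_of_im_pos hw
    obtain ⟨hv, hv'⟩ := abs_lt.1 (abs_arg_neg_I_mul_lt him)
    rw [cpow_mul_cpow_eq_exp_mul (θ := π / 2) hω₂ (neg_I_mul_ne_zero him) hw0 one_ne_zero,
      one_cpow, mul_one]
    · congr 2
      push_cast
      ring
    · have h : cexp ((π / 2 : ℝ) * I) = I := by
        push_cast
        rw [Complex.exp_pi_div_two_mul_I]
      rw [h, hξ₄_def]
      push_cast
      field_simp
      ring
    · rw [arg_one, abs_lt]
      constructor <;> linarith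
  have hQ₂ : ω₁ ^ (-s : ℂ) *
      ∑' p : ℕ × ℕ, (-I * (ξ₁ - (p.1 + 1) + p.2 * (ω₂ / ω₁))) ^ (-s : ℂ) =
      ω₂ ^ (-s : ℂ) * ∑' p : ℕ × ℕ, (-I * (ξ₂ + p.1 + p.2 * -(ω₁ / ω₂))) ^ (-s : ℂ) := by
    rw [← tsum_mul_left, ← tsum_mul_left, ← (Equiv.prodComm ℕ ℕ).tsum_eq]
    refine tsum_congr fun ⟨m, n⟩ ↦ ?_
    simp only [Equiv.prodComm_apply, Prod.swap_prod_mk]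
    have him := im_sub_natCast_add_pos hξ₁ hτ n m
    have him' := im_add_natCast_add_pos hξ₂ hτ' m n
    obtain ⟨hv, hv'⟩ := abs_lt.1 (abs_arg_neg_I_mul_lt him)
    obtain ⟨hu, hu'⟩ := abs_lt.1 (abs_arg_neg_I_mul_lt him')
    rw [cpow_mul_cpow_eq_exp_mul (θ := 0) hω₁ (neg_I_mul_ne_zero him) hω₂
      (neg_I_mul_ne_zero him')]
    · simp
    · rw [hξ₁_def, hξ₂_def]
      push_cast
      rw [zero_mul, Complex.exp_zero]
      field_simp
      ring
    · rw [abs_lt]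
      constructor <;> linarith
  have hQ₃ : ω₂ ^ (-s : ℂ) *
      ∑' p : ℕ × ℕ, (-I * (ξ₂ - (p.1 + 1) + p.2 * -(ω₁ / ω₂))) ^ (-s : ℂ) =
      cexp (-(π * I * s)) *
        (ω₁ ^ (-s : ℂ) * ∑' p : ℕ × ℕ, (-I * (ξ₃ + p.1 + p.2 * (ω₂ / ω₁))) ^ (-s : ℂ)) := by
    rw [← tsum_mul_left, ← tsum_mul_left, ← tsum_mul_left, ← (Equiv.prodComm ℕ ℕ).tsum_eq]
    refine tsum_congr fun ⟨m, n⟩ ↦ ?_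
    simp only [Equiv.prodComm_apply, Prod.swap_prod_mk]
    have him := im_sub_natCast_add_pos hξ₂ hτ' n m
    have him' := im_add_natCast_add_pos hξ₃ hτ m n
    obtain ⟨hv, hv'⟩ := abs_lt.1 (abs_arg_neg_I_mul_lt him)
    obtain ⟨hu, hu'⟩ := abs_lt.1 (abs_arg_neg_I_mul_lt him')
    rw [cpow_mul_cpow_eq_exp_mul (θ := π) hω₂ (neg_I_mul_ne_zero him) hω₁
      (neg_I_mul_ne_zero him')]
    · congr 2
      ring
    · rw [hξ₂_def, hξ₃_def, Complex.exp_pi_mul_I]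
      push_cast
      field_simp
      ring
    · rw [abs_lt]
      constructor <;> linarith
  have hQ₄ : ω₁ ^ (-s : ℂ) *
      ∑' p : ℕ × ℕ, (-I * (ξ₃ - (p.1 + 1) + p.2 * (ω₂ / ω₁))) ^ (-s : ℂ) =
      ω₂ ^ (-s : ℂ) * ∑' p : ℕ × ℕ, (-I * (ξ₄ + p.1 + p.2 * -(ω₁ / ω₂))) ^ (-s : ℂ) := by
    rw [← tsum_mul_left, ← tsum_mul_left, ← (Equiv.prodComm ℕ ℕ).tsum_eq]
    refine tsum_congr fun ⟨m, n⟩ ↦ ?_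
    simp only [Equiv.prodComm_apply, Prod.swap_prod_mk]
    have him := im_sub_natCast_add_pos hξ₃ hτ n m
    have him' := im_add_natCast_add_pos hξ₄ hτ' m n
    obtain ⟨hv, hv'⟩ := abs_lt.1 (abs_arg_neg_I_mul_lt him)
    obtain ⟨hu, hu'⟩ := abs_lt.1 (abs_arg_neg_I_mul_lt him')
    rw [cpow_mul_cpow_eq_exp_mul (θ := 0) hω₁ (neg_I_mul_ne_zero him) hω₂
      (neg_I_mul_ne_zero him')]
    · simp
    · rw [hξ₃_def, hξ₄_def]
      push_cast
      rw [zero_mul, Complex.exp_zero]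
      field_simp
      ring
    · rw [abs_lt]
      constructor <;> linarith
  have hG : Complex.Gamma s ≠ 0 := Complex.Gamma_ne_zero_of_re_pos (by simp; linarith)
  have hpi : (2 * π : ℂ) ≠ 0 := by simp [Real.pi_ne_zero]
  set e : ℂ := cexp (π * I * s / 2) with he_def
  have he : e ≠ 0 := Complex.exp_ne_zero _
  have he₁ : cexp (-(π * I * s / 2)) = e⁻¹ := Complex.exp_neg _
  have he₂ : cexp (-(π * I * s)) = e⁻¹ ^ 2 := by
    rw [← he₁, ← Complex.exp_nat_mul]
    congr 1
    push_cast
    ring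
  have hE : cexp (π * I * (s - 1) / 2) = -I * e := by
    rw [show (π * I * (s - 1) / 2 : ℂ) = π * I * s / 2 - π / 2 * I by ring, Complex.exp_sub,
      Complex.exp_pi_div_two_mul_I, div_eq_mul_inv, inv_I, mul_comm]
  have hE' : cexp (-(π * I * (s - 1)) / 2) = I * e⁻¹ := by
    rw [show (-(π * I * (s - 1)) / 2 : ℂ) = -(π * I * (s - 1) / 2) by ring, Complex.exp_neg, hE,
      mul_inv, inv_neg, inv_I, neg_neg]
  have hsin' : Complex.sin (π * s) = (e⁻¹ ^ 2 - e ^ 2) * I / 2 := by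
    rw [Complex.sin, ← he₁, ← Complex.exp_nat_mul, he_def, ← Complex.exp_nat_mul]
    push_cast
    ring_nf
  have hrefl := Complex.Gamma_mul_Gamma_one_sub s
  rw [he₁] at hQ₁'
  rw [he₂] at hQ₃
  rw [hE, hE']
  set Z := barnesZeta2 s (a₁ * ω₁ + a₂ * ω₂) ω₁ ω₂
  set K : ℂ := (2 * π : ℂ) ^ (s : ℂ) / Complex.Gamma s with hK
  have hK0 : K ≠ 0 := div_ne_zero (by simp [cpow_eq_zero_iff, Real.pi_ne_zero]) hG
  have hbracket : K * (-I * e * (ω₁ ^ (-s : ℂ) * expQuotientSeries ξ₁ (ω₂ / ω₁) s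
        + ω₂ ^ (-s : ℂ) * -expQuotientSeries ξ₂ (-(ω₁ / ω₂)) s)
      + I * e⁻¹ * (ω₁ ^ (-s : ℂ) * -expQuotientSeries ξ₃ (ω₂ / ω₁) s
        + ω₂ ^ (-s : ℂ) * expQuotientSeries ξ₄ (-(ω₁ / ω₂)) s)) =
      2 * Complex.sin (π * s) * Z := by
    have hee : e * e⁻¹ = 1 := mul_inv_cancel₀ he
    clear_value K Z e
    generalize e⁻¹ = f at *
    linear_combination I * e * ω₁ ^ (-s : ℂ) * H₁ - I * e * ω₂ ^ (-s : ℂ) * H₂ +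
      I * f * ω₁ ^ (-s : ℂ) * H₃ - I * f * ω₂ ^ (-s : ℂ) * H₄ - I * e * hQ₁ - I * e * hQ₂ +
      I * e * hQ₃ - I * f * hQ₄ + I * f * hQ₁' - 2 * Z * hsin' + I * f * ω₁ ^ (-s : ℂ) *
      (∑' p : ℕ × ℕ, (-I * (ξ₃ + p.1 + p.2 * (ω₂ / ω₁))) ^ (-s : ℂ)) * hee
  have hconst : (2 * π : ℂ) ^ (s - 1 : ℂ) * Complex.Gamma (1 - s) * (2 * Complex.sin (π * s)) =
      K := by
    rw [hK, cpow_sub _ _ hpi, cpow_one, eq_div_iff hG]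
    rw [eq_div_iff hsin] at hrefl
    have hpi' : (π : ℂ) ≠ 0 := by simp [Real.pi_ne_zero]
    field_simp
    linear_combination hrefl
  refine mul_left_cancel₀ hK0 ?_
  rw [mul_left_comm, hbracket, ← hconst]
  ring

theorem div_one_sub_eq_neg {x q : ℂ} (hq : q ≠ 0) : x / (1 - q) = -(x * q⁻¹ / (1 - q⁻¹)) := by
  by_cases h : q = 1
  · simp [h]
  · have h1 : 1 - q ≠ 0 := sub_ne_zero.2 (Ne.symm h)
    have h2 : q - 1 ≠ 0 := sub_ne_zero.2 h
    field_simp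
    rw [← neg_sub q 1]
    field_simp

theorem cexp_add_two_pi_mul_natCast_add_one (w : ℂ) (n : ℕ) :
    cexp (w + 2 * π * I * ((n : ℂ) + 1)) = cexp w := by
  have h : cexp (2 * π * I * ((n : ℂ) + 1)) = 1 :=
    Complex.exp_eq_one_iff.2 ⟨n + 1, by push_cast; ring⟩
  rw [Complex.exp_add, h, mul_one]

theorem tsum_div_one_sub_eq_expQuotientSeries {u v : ℕ → ℂ} {ξ τ s : ℂ}
    (hu : ∀ n, cexp (u n) = cexp (2 * π * I * ((n : ℂ) + 1) * ξ))
    (hv : ∀ n, cexp (v n) = cexp (2 * π * I * ((n : ℂ) + 1) * τ)) :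
    ∑' n : ℕ, ((n : ℂ) + 1) ^ (s - 1) * cexp (u n) / (1 - cexp (v n)) =
      expQuotientSeries ξ τ s := by
  simp only [hu, hv, expQuotientSeries]

theorem tsum_div_one_sub_eq_neg_expQuotientSeries {u v : ℕ → ℂ} {ξ τ s : ℂ}
    (hu : ∀ n, cexp (u n - v n) = cexp (2 * π * I * ((n : ℂ) + 1) * ξ))
    (hv : ∀ n, cexp (-v n) = cexp (2 * π * I * ((n : ℂ) + 1) * τ)) :
    ∑' n : ℕ, ((n : ℂ) + 1) ^ (s - 1) * cexp (u n) / (1 - cexp (v n)) =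
      -expQuotientSeries ξ τ s := by
  rw [expQuotientSeries, ← tsum_neg]
  refine tsum_congr fun n ↦ ?_
  rw [div_one_sub_eq_neg (Complex.exp_ne_zero _), ← Complex.exp_neg, mul_assoc, ← Complex.exp_add,
    ← sub_eq_add_neg, hu, hv]

theorem eqOn_of_frequently_eq_ofReal {f g : ℂ → ℂ} {S : Set ℂ} (hS : S.Countable)
    (hSc : IsClosed S) (hf : DifferentiableOn ℂ f Sᶜ) (hg : DifferentiableOn ℂ g Sᶜ) {x₀ : ℝ}
    (hx₀ : (x₀ : ℂ) ∉ S) (hfg : ∀ᶠ x : ℝ in 𝓝[≠] x₀, f x = g x) : EqOn f g Sᶜ := by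
  have hconn : IsPreconnected Sᶜ :=
    (hS.isPathConnected_compl_of_one_lt_rank
      (by rw [Complex.rank_real_complex]; exact Nat.one_lt_ofNat)).isConnected.isPreconnected
  refine (hf.analyticOnNhd hSc.isOpen_compl).eqOn_of_preconnected_of_frequently_eq
    (hg.analyticOnNhd hSc.isOpen_compl) hconn hx₀ ?_
  have htend : Tendsto (fun x : ℝ ↦ (x : ℂ)) (𝓝[≠] x₀) (𝓝[≠] (x₀ : ℂ)) :=
    tendsto_nhdsWithin_of_tendsto_nhds_of_eventually_within _
      (Complex.continuous_ofReal.tendsto x₀ |>.mono_left nhdsWithin_le_nhds)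
      (eventually_nhdsWithin_of_forall fun x hx ↦ by simpa using hx)
  exact htend.frequently hfg.frequently

theorem isClosed_range_natCast_add_one : IsClosed (range fun n : ℕ ↦ (n : ℂ) + 1) := by
  have h := ((Homeomorph.addRight (1 : ℂ)).isClosedEmbedding.comp
    (Complex.isometry_ofReal.isClosedEmbedding.comp Nat.isClosedEmbedding_coe_real)).isClosed_range
  convert h using 2
  ext n
  simp

theorem differentiableOn_Gamma_one_sub :
    DifferentiableOn ℂ (fun s ↦ Complex.Gamma (1 - s)) (range fun n : ℕ ↦ (n : ℂ) + 1)ᶜ := by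
  intro s hs
  refine ((Complex.differentiableAt_Gamma (1 - s) fun n h ↦ hs ⟨n, ?_⟩).comp s
    (differentiableAt_id.const_sub 1)).differentiableWithinAt
  linear_combination h

theorem sin_pi_mul_ne_zero_of_mem_Ioo {x : ℝ} (hx : x ∈ Ioo (2 : ℝ) 3) :
    Complex.sin (π * x) ≠ 0 := by
  have h : Real.sin (π * x - 2 * π) ≠ 0 :=
    (Real.sin_pos_of_pos_of_lt_pi (by nlinarith [hx.1, Real.pi_pos])
      (by nlinarith [hx.2, Real.pi_pos])).ne'
  rw [Real.sin_sub_two_pi] at h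
  exact_mod_cast h

end

/-- Fourier expansion of the Barnes double zeta function: `F` denotes its analytic
continuation (analytic away from the poles `s = 1, 2`); the stated identity holds at
every point where both sides are defined, i.e. for `s` not a positive integer
(at `s = 1, 2` the left side has poles, and at integers `s ≥ 3` the factor `Γ(1−s)`
has poles compensated by vanishing of the bracket). -/
theorem barnesZeta2_fourier (ω₁ ω₂ : ℂ) (h₁ : 0 < ω₁.im) (h₂ : 0 < ω₂.im)
    (harg : ω₁.arg < ω₂.arg)
    (a₁ a₂ : ℝ) (ha₁ : 0 < a₁) (ha₁' : a₁ < 1) (ha₂ : 0 < a₂) (ha₂' : a₂ < 1)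
    (z : ℂ) (hz : z = a₁ * ω₁ + a₂ * ω₂)
    (F : ℂ → ℂ) (hF : DifferentiableOn ℂ F {(1 : ℂ), 2}ᶜ)
    (hagree : ∀ s : ℂ, 2 < s.re → F s = barnesZeta2 s z ω₁ ω₂)
    (s : ℂ) (hs : ¬∃ n : ℕ, s = (n : ℂ) + 1) :
    F s = (2 * π : ℂ) ^ (s - 1) * Complex.Gamma (1 - s) *
      (Complex.exp (π * I * (s - 1) / 2) *
          (ω₁ ^ (-s) * ∑' n : ℕ, ((n : ℂ) + 1) ^ (s - 1) *
              Complex.exp (2 * π * I * ((n : ℂ) + 1) * z / ω₁)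
                / (1 - Complex.exp (2 * π * I * ((n : ℂ) + 1) * ω₂ / ω₁))
            + ω₂ ^ (-s) * ∑' n : ℕ, ((n : ℂ) + 1) ^ (s - 1) *
              Complex.exp (2 * π * I * ((n : ℂ) + 1) * z / ω₂)
                / (1 - Complex.exp (2 * π * I * ((n : ℂ) + 1) * ω₁ / ω₂)))
        + Complex.exp (-(π * I * (s - 1)) / 2) *
          (ω₁ ^ (-s) * ∑' n : ℕ, ((n : ℂ) + 1) ^ (s - 1) *
              Complex.exp (-(2 * π * I * ((n : ℂ) + 1)) * z / ω₁)
                / (1 - Complex.exp (-(2 * π * I * ((n : ℂ) + 1)) * ω₂ / ω₁))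
            + ω₂ ^ (-s) * ∑' n : ℕ, ((n : ℂ) + 1) ^ (s - 1) *
              Complex.exp (-(2 * π * I * ((n : ℂ) + 1)) * z / ω₂)
                / (1 - Complex.exp (-(2 * π * I * ((n : ℂ) + 1)) * ω₁ / ω₂)))) := by
  have hω₁ : ω₁ ≠ 0 := fun h ↦ by simp [h] at h₁
  have hω₂ : ω₂ ≠ 0 := fun h ↦ by simp [h] at h₂
  have hτ := div_im_pos_of_arg_lt h₁ h₂ harg
  have hτ' := neg_div_im_pos_of_arg_lt h₁ h₂ harg
  rw [tsum_div_one_sub_eq_expQuotientSeries (ξ := a₁ + a₂ * (ω₂ / ω₁)) (τ := ω₂ / ω₁),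
    tsum_div_one_sub_eq_neg_expQuotientSeries (ξ := a₂ + (1 - a₁ : ℝ) * -(ω₁ / ω₂))
      (τ := -(ω₁ / ω₂)),
    tsum_div_one_sub_eq_neg_expQuotientSeries
      (ξ := (1 - a₁ : ℝ) + (1 - a₂ : ℝ) * (ω₂ / ω₁)) (τ := ω₂ / ω₁),
    tsum_div_one_sub_eq_expQuotientSeries (ξ := (1 - a₂ : ℝ) + a₁ * -(ω₁ / ω₂))
      (τ := -(ω₁ / ω₂))]
  rotate_left
  · intro n
    rw [← cexp_add_two_pi_mul_natCast_add_one _ n, hz]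
    congr 1
    push_cast
    field_simp
    ring
  · intro n
    congr 1
    ring
  · intro n
    rw [← cexp_add_two_pi_mul_natCast_add_one _ n, hz]
    congr 1
    push_cast
    field_simp
    ring
  · intro n
    congr 1
    ring
  · intro n
    rw [hz]
    congr 1
    push_cast
    field_simp
    ring
  · intro n
    congr 1
    ring
  · intro n
    rw [hz]
    congr 1
    field_simp
  · intro n
    congr 1
    ring
  have hdiff₁ := differentiable_expQuotientSeries (im_real_add_mul_pos hτ a₁ ha₂) hτ
  have hdiff₂ := differentiable_expQuotientSeries
    (im_real_add_mul_pos hτ' a₂ (sub_pos.2 ha₁')) hτ'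
  have hdiff₃ := differentiable_expQuotientSeries
    (im_real_add_mul_pos hτ (1 - a₁) (sub_pos.2 ha₂')) hτ
  have hdiff₄ := differentiable_expQuotientSeries (im_real_add_mul_pos hτ' (1 - a₂) ha₁) hτ'
  have hpow (ω : ℂ) (hω : ω ≠ 0) : Differentiable ℂ fun s : ℂ ↦ ω ^ (-s) :=
    differentiable_neg.const_cpow (.inl hω)
  have hpow₁ := hpow ω₁ hω₁
  have hpow₂ := hpow ω₂ hω₂
  have hpow' : Differentiable ℂ fun s : ℂ ↦ (2 * π : ℂ) ^ (s - 1) :=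
    (differentiable_id.sub_const 1).const_cpow (.inl (by simp [Real.pi_ne_zero]))
  refine eqOn_of_frequently_eq_ofReal (x₀ := 5 / 2) (Set.countable_range _)
    isClosed_range_natCast_add_one (f := F) (g := fun s ↦
      (2 * π : ℂ) ^ (s - 1) * Complex.Gamma (1 - s) *
      (cexp (π * I * (s - 1) / 2) *
          (ω₁ ^ (-s) * expQuotientSeries (a₁ + a₂ * (ω₂ / ω₁)) (ω₂ / ω₁) s
            + ω₂ ^ (-s) * -expQuotientSeries (a₂ + (1 - a₁ : ℝ) * -(ω₁ / ω₂)) (-(ω₁ / ω₂)) s)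
        + cexp (-(π * I * (s - 1)) / 2) *
          (ω₁ ^ (-s) *
              -expQuotientSeries ((1 - a₁ : ℝ) + (1 - a₂ : ℝ) * (ω₂ / ω₁)) (ω₂ / ω₁) s
            + ω₂ ^ (-s) *
              expQuotientSeries ((1 - a₂ : ℝ) + a₁ * -(ω₁ / ω₂)) (-(ω₁ / ω₂)) s)))
    (hF.mono ?_) ?_ ?_ ?_ fun ⟨n, hn⟩ ↦ hs ⟨n, hn.symm⟩
  · rw [Set.compl_subset_compl]
    rintro _ (rfl | rfl)
    · exact ⟨0, by simp⟩
    · exact ⟨1, by norm_num⟩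
  · refine (hpow'.differentiableOn.mul differentiableOn_Gamma_one_sub).mul
      (Differentiable.differentiableOn ?_)
    fun_prop
  · rintro ⟨n, hn⟩
    have h : (2 * (n + 1) : ℂ) = 5 := by
      simp only at hn
      rw [hn]
      push_cast
      norm_num
    norm_cast at h
    omega
  · filter_upwards [nhdsWithin_le_nhds (Ioo_mem_nhds (by norm_num : (2 : ℝ) < 5 / 2)
      (by norm_num : (5 / 2 : ℝ) < 3))] with x hx
    rw [hagree _ hx.1, hz]
    exact barnesZeta2_eq_expQuotientSeries h₁ h₂ harg ha₁ ha₁' ha₂ ha₂' hx.1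
      (sin_pi_mul_ne_zero_of_mem_Ioo hx)
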